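/- Let K be an abstract simplicial complex on [m] with {i} ∈ K. Define the additive map ϖ_i : R*_K → R*_{K(v_i)} on basis monomials by ϖ_i(u^σ t^τ) = u^{χ_i(σ)} t^{χ_i(τ)} if i ∉ σ∪τ, and ϖ_i(u^σ t^τ) = u^{χ_i(σ)} t^{χ_i(τ)} u^{i+1} if i ∈ σ∪τ. Then ϖ_i commutes with the differentials, and it induces, for every ω ⊆ [m] and every p ≥ 0, isomorphisms H^p(R*_K|_ω) ≅ H^{p+1}(R*_{K(v_i)}|_{χ_i(ω)∪{i+1}}) when i ∈ ω, and H^p(R*_K|_ω) ≅ H^p(R*_{K(v_i)}|_{χ_i(ω)}) when i ∉ ω; in particular ϖ_i induces an additive isomorphism H*(R*_K) ≅ H*(R*_{K(v_i)}). -/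

import Mathlib

set_option synthInstance.maxHeartbeats 1000000
set_option maxHeartbeats 1000000

structure ASC (m : ℕ) where
  faces : Set (Finset (Fin m))
  empty_mem : ∅ ∈ faces
  down_closed : ∀ {σ τ : Finset (Fin m)}, σ ∈ faces → τ ⊆ σ → τ ∈ faces

variable {n : ℕ}

/-- index of the square-free monomials `u^σ t^τ`. -/
def MonIdx (F : Set (Finset (Fin n))) : Type :=
  {p : Finset (Fin n) × Finset (Fin n) // p.1 ∈ F ∧ Disjoint p.1 p.2}

/-- the free `ℤ`-module on the square-free monomials: the underlying module of `R*_K`. -/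
abbrev RMod (F : Set (Finset (Fin n))) : Type := MonIdx F →₀ ℤ

/-- (cohomological) degree of `u^σ t^τ` is `card σ`. -/
def degMon1 {F : Set (Finset (Fin n))} (b : MonIdx F) : ℤ := b.1.1.card

/-- the set of indices appearing in the word `u^σ t^τ` -/
def wrd {F : Set (Finset (Fin n))} (b : MonIdx F) : Finset (Fin n) := b.1.1 ∪ b.1.2

open Classical in
/-- the differential of `R*_K` : `d t^i = u^i`, `d u^i = 0` and the Leibniz rule, i.e.
`d(u^σ t^τ) = ∑_{i ∈ τ, σ∪{i} ∈ K} (-1)^{(i,σ)} u^{σ∪{i}} t^{τ∖{i}}`. -/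
noncomputable def dR (F : Set (Finset (Fin n))) : RMod F →ₗ[ℤ] RMod F :=
  Finsupp.lift (RMod F) ℤ (MonIdx F) fun b =>
    ∑ i ∈ b.1.2,
      if h : insert i b.1.1 ∈ F then
        ((-1 : ℤ) ^ ((b.1.1.filter (fun k => k < i)).card)) •
          Finsupp.single (⟨(insert i b.1.1, b.1.2.erase i),
            ⟨h, by
              refine Finset.disjoint_left.2 fun a ha hb => ?_
              rcases Finset.mem_insert.1 ha with h' | h'
              · exact (Finset.mem_erase.1 hb).1 h'
              · exact (Finset.disjoint_left.1 b.2.2 h') (Finset.mem_of_mem_erase hb)⟩⟩ :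
              MonIdx F) (1 : ℤ)
      else 0

open Classical in
/-- product of square-free monomials in `R*_K` (`J = (1,…,1)`) -/
noncomputable def mulMon (F : Set (Finset (Fin n))) (a b : MonIdx F) : RMod F :=
  if h : (a.1.1 ∪ b.1.1) ∈ F ∧ Disjoint a.1.1 b.1.1 ∧ Disjoint a.1.2 b.1.1 then
    ((-1 : ℤ) ^ (∑ i ∈ a.1.1, ((b.1.1).filter (fun k => k < i)).card)) •
      Finsupp.single (⟨(a.1.1 ∪ b.1.1, (a.1.2 ∪ b.1.2) \ (a.1.1 ∪ b.1.1)),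
        ⟨h.1, Finset.disjoint_sdiff⟩⟩ : MonIdx F) (1 : ℤ)
  else 0

/-- the product on `R*_K`, extended bilinearly -/
noncomputable def mulR (F : Set (Finset (Fin n))) :
    RMod F →ₗ[ℤ] RMod F →ₗ[ℤ] RMod F :=
  Finsupp.lift (RMod F →ₗ[ℤ] RMod F) ℤ (MonIdx F) fun a =>
    Finsupp.lift (RMod F) ℤ (MonIdx F) fun b => mulMon F a b

open Classical in
/-- the generator `u^k` -/
noncomputable def genV (F : Set (Finset (Fin n))) (k : Fin n) : RMod F :=
  if h : ({k} : Finset (Fin n)) ∈ F then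
    Finsupp.single (⟨({k}, ∅), ⟨h, by simp⟩⟩ : MonIdx F) (1 : ℤ)
  else 0

open Classical in
noncomputable def partSub {ι α : Type*} (f : ι → α) (a : α) : Submodule ℤ (ι →₀ ℤ) where
  carrier := {x | ∀ b ∈ x.support, f b = a}
  add_mem' := by
    intro x y hx hy b hb
    rcases Finset.mem_union.1 (Finsupp.support_add hb) with h | h
    · exact hx b h
    · exact hy b h
  zero_mem' := by intro b hb; simp at hb
  smul_mem' := by
    intro c x hx b hb
    exact hx b (Finsupp.support_smul hb)

/-- the relabeling `χ_i : [m] → [m+1]`. -/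
def chi {m : ℕ} (i : Fin m) (j : Fin m) : Fin (m + 1) :=
  if (j : ℕ) ≤ (i : ℕ) then j.castSucc else j.succ

def chiF {m : ℕ} (i : Fin m) (σ : Finset (Fin m)) : Finset (Fin (m + 1)) :=
  σ.image (chi i)

/-- the faces of the simplicial wedge `K(v_i)`. -/
def wedgeFaces {m : ℕ} (K : ASC m) (i : Fin m) : Set (Finset (Fin (m + 1))) :=
  {s | ∃ (α : Finset (Fin (m + 1))) (t : Finset (Fin m)), s = α ∪ chiF i t ∧
      ((α ⊆ {i.castSucc} ∧ t ∈ K.faces ∧ i ∉ t) ∨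
       (α ⊆ {i.succ} ∧ t ∈ K.faces ∧ i ∉ t) ∨
       (α ⊆ {i.castSucc, i.succ} ∧ t ∈ K.faces ∧ i ∉ t ∧ insert i t ∈ K.faces))}

section

variable {m : ℕ} (K : ASC m) (i : Fin m)

open Classical in
/-- the additive map `ϖ_i : R*_K → R*_{K(v_i)}` :
`u^σ t^τ ↦ u^{χ_i(σ)} t^{χ_i(τ)}` if `i ∉ σ∪τ` and
`u^σ t^τ ↦ u^{χ_i(σ)} t^{χ_i(τ)} u^{i+1}` otherwise. -/
noncomputable def varpi : RMod K.faces →ₗ[ℤ] RMod (wedgeFaces K i) :=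
  Finsupp.lift (RMod (wedgeFaces K i)) ℤ (MonIdx K.faces) fun b =>
    if h : chiF i b.1.1 ∈ wedgeFaces K i ∧ Disjoint (chiF i b.1.1) (chiF i b.1.2) then
      (if i ∈ b.1.1 ∪ b.1.2 then
        mulR (wedgeFaces K i)
          (Finsupp.single (⟨(chiF i b.1.1, chiF i b.1.2), h⟩ :
            MonIdx (wedgeFaces K i)) (1 : ℤ))
          (genV (wedgeFaces K i) i.succ)
      else
        Finsupp.single (⟨(chiF i b.1.1, chiF i b.1.2), h⟩ :
          MonIdx (wedgeFaces K i)) (1 : ℤ))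
    else 0

/-! ### Auxiliary lemmas -/

open Classical in
/-- The monomial `u^σ t^τ`, zero when it is not admissible. -/
noncomputable def mon (F : Set (Finset (Fin n))) (σ τ : Finset (Fin n)) : RMod F :=
  if h : σ ∈ F ∧ Disjoint σ τ then Finsupp.single (⟨(σ, τ), h⟩ : MonIdx F) (1 : ℤ) else 0

/-- The sign `(-1)^{(v,σ)}`. -/
def sgn (v : Fin n) (σ : Finset (Fin n)) : ℤ := (-1) ^ (σ.filter (fun k => k < v)).card


theorem single_eq_mon {F : Set (Finset (Fin n))} (b : MonIdx F) :
    Finsupp.single b (1 : ℤ) = mon F b.1.1 b.1.2 := by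
  unfold mon
  rw [dif_pos b.2]
  rfl

theorem mon_zero {F : Set (Finset (Fin n))} {σ τ : Finset (Fin n)} (h : σ ∉ F) :
    mon F σ τ = 0 := by
  unfold mon
  rw [dif_neg (fun h' => h h'.1)]

theorem lin_ext {F : Set (Finset (Fin n))} {M : Type*} [AddCommGroup M]
    (f g : RMod F →ₗ[ℤ] M)
    (h : ∀ σ τ, σ ∈ F → Disjoint σ τ → f (mon F σ τ) = g (mon F σ τ)) : f = g := by
  apply Finsupp.lhom_ext'
  intro b
  apply LinearMap.ext_ring
  have := h b.1.1 b.1.2 b.2.1 b.2.2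
  rw [← single_eq_mon] at this
  exact this

theorem lift_mon {F : Set (Finset (Fin n))} {M : Type*} [AddCommGroup M]
    (g : MonIdx F → M) {σ τ : Finset (Fin n)} (h : σ ∈ F ∧ Disjoint σ τ) :
    Finsupp.lift M ℤ (MonIdx F) g (mon F σ τ) = g ⟨(σ, τ), h⟩ := by
  unfold mon
  rw [dif_pos h]
  exact (Finsupp.sum_single_index (by simp)).trans (one_smul ℤ _)

theorem sgn_sq (v : Fin n) (σ : Finset (Fin n)) : sgn v σ * sgn v σ = 1 := by
  unfold sgn
  rw [← mul_pow]; simp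

theorem sgn_insert (v j : Fin n) (σ : Finset (Fin n)) (hj : j ∉ σ) :
    sgn v (insert j σ) = (if j < v then -1 else 1) * sgn v σ := by
  unfold sgn
  rw [Finset.filter_insert]
  split_ifs with h
  · rw [Finset.card_insert_of_notMem (by simp [hj]), pow_succ]; ring
  · simp

theorem dR_mon {F : Set (Finset (Fin n))} (hF : ∀ σ τ, σ ∈ F → τ ⊆ σ → τ ∈ F)
    {σ τ : Finset (Fin n)} (hd : Disjoint σ τ) :
    dR F (mon F σ τ) = ∑ j ∈ τ, sgn j σ • mon F (insert j σ) (τ.erase j) := by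
  by_cases h : σ ∈ F
  · unfold dR
    rw [lift_mon _ ⟨h, hd⟩]
    apply Finset.sum_congr rfl
    intro j hj
    have hd' : Disjoint (insert j σ) (τ.erase j) := by
      rw [Finset.disjoint_left] at *
      intro x hx
      have := @hd x
      simp only [Finset.mem_insert, Finset.mem_erase] at *
      tauto
    by_cases h1 : insert j σ ∈ F
    · refine (dif_pos h1).trans ?_
      unfold mon
      rw [dif_pos ⟨h1, hd'⟩]
      rfl
    · refine (dif_neg h1).trans ?_
      rw [mon_zero h1, smul_zero]
  · rw [mon_zero h, map_zero]
    symm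
    apply Finset.sum_eq_zero
    intro j hj
    rw [mon_zero (fun h' => h (hF _ _ h' (Finset.subset_insert _ _))), smul_zero]

theorem disj_step {σ τ : Finset (Fin n)} (hd : Disjoint σ τ) (j : Fin n) :
    Disjoint (insert j σ) (τ.erase j) := by
  rw [Finset.disjoint_left] at *
  intro x hx
  have := @hd x
  simp only [Finset.mem_insert, Finset.mem_erase] at *
  tauto

theorem dR_dR {F : Set (Finset (Fin n))} (hF : ∀ σ τ, σ ∈ F → τ ⊆ σ → τ ∈ F) (x : RMod F) :
    dR F (dR F x) = 0 := by
  suffices h : (dR F).comp (dR F) = 0 from LinearMap.congr_fun h x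
  apply lin_ext
  intro σ τ hσ hd
  rw [LinearMap.comp_apply, dR_mon hF hd, map_sum, LinearMap.zero_apply]
  have e : ∀ j ∈ τ, dR F (sgn j σ • mon F (insert j σ) (τ.erase j)) =
      ∑ k ∈ τ, if k = j then 0 else
        (sgn j σ * sgn k (insert j σ)) • mon F (insert k (insert j σ)) ((τ.erase j).erase k) := by
    intro j hj
    rw [map_smul, dR_mon hF (disj_step hd j), Finset.smul_sum]
    rw [← Finset.add_sum_erase τ _ hj, if_pos rfl, zero_add]
    apply Finset.sum_congr rfl
    intro k hk
    rw [if_neg (Finset.ne_of_mem_erase hk), smul_smul]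
  rw [Finset.sum_congr rfl e]
  rw [← self_eq_neg]
  conv_lhs => rw [Finset.sum_comm]
  rw [← Finset.sum_neg_distrib]
  apply Finset.sum_congr rfl
  intro j hj
  rw [← Finset.sum_neg_distrib]
  apply Finset.sum_congr rfl
  intro k hk
  by_cases hjk : j = k
  · subst hjk; simp
  · rw [if_neg hjk, if_neg (Ne.symm hjk), Finset.insert_comm, Finset.erase_right_comm, ← neg_smul]
    congr 1
    have hj' : j ∉ σ := fun h => Finset.disjoint_left.1 hd h hj
    have hk' : k ∉ σ := fun h => Finset.disjoint_left.1 hd h hk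
    rw [sgn_insert _ _ _ hj', sgn_insert _ _ _ hk']
    rcases lt_or_gt_of_ne hjk with h | h
    · rw [if_pos h, if_neg (not_lt.2 h.le)]; ring
    · rw [if_pos h, if_neg (not_lt.2 h.le)]; ring

/-- The cone computation. -/
theorem cone_lem {F : Set (Finset (Fin n))} {v : Fin n} {ρ τ : Finset (Fin n)}
    (hd : Disjoint (insert v ρ) τ) (hv : v ∉ ρ) :
    sgn v ρ • ∑ j ∈ insert v τ, sgn j ρ • mon F (insert j ρ) ((insert v τ).erase j) =
      mon F (insert v ρ) τ - ∑ j ∈ τ, (sgn j (insert v ρ) * sgn v (insert j ρ)) •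
        mon F (insert j ρ) (insert v (τ.erase j)) := by
  have hvt : v ∉ τ := fun h => Finset.disjoint_left.1 hd (Finset.mem_insert_self _ _) h
  rw [Finset.sum_insert hvt, smul_add, smul_smul, sgn_sq, one_smul, Finset.erase_insert hvt,
    sub_eq_add_neg, ← Finset.sum_neg_distrib, Finset.smul_sum]
  congr 1
  apply Finset.sum_congr rfl
  intro j hj
  have hj' : j ∉ ρ := fun h => Finset.disjoint_left.1 hd (Finset.mem_insert_of_mem h) hj
  have hjv : j ≠ v := fun h => hvt (h ▸ hj)
  rw [Finset.erase_insert_of_ne hjv.symm, smul_smul, ← neg_smul]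
  congr 1
  rw [sgn_insert _ _ _ hj', sgn_insert _ _ _ hv]
  rcases lt_or_gt_of_ne hjv with h | h
  · rw [if_pos h, if_neg (not_lt.2 h.le)]; ring
  · rw [if_pos h, if_neg (not_lt.2 h.le)]; ring

/-! ### Combinatorics of the wedge -/

/-- preimage under `χ_i`. -/
def tt {m : ℕ} (i : Fin m) (A : Finset (Fin (m + 1))) : Finset (Fin m) :=
  Finset.univ.filter (fun j => chi i j ∈ A)

theorem chi_self {m : ℕ} (i : Fin m) : chi i i = i.castSucc := by simp [chi]

theorem chi_lt {m : ℕ} (i j k : Fin m) : chi i j < chi i k ↔ j < k := by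
  unfold chi
  split_ifs <;> simp only [Fin.lt_def, Fin.val_castSucc, Fin.val_succ] <;> omega

theorem chi_inj {m : ℕ} (i : Fin m) : Function.Injective (chi i) := by
  intro j k h
  apply le_antisymm
  · rw [← not_lt, ← chi_lt i, h]; simp
  · rw [← not_lt, ← chi_lt i, h]; simp

theorem chi_ne {m : ℕ} (i j : Fin m) : chi i j ≠ i.succ := by
  unfold chi
  intro h
  split_ifs at h <;> simp only [Fin.ext_iff, Fin.val_castSucc, Fin.val_succ] at h <;> omega

theorem chi_surj {m : ℕ} (i : Fin m) (x : Fin (m + 1)) (hx : x ≠ i.succ) : ∃ j, chi i j = x := by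
  have hx' : (x : ℕ) ≠ i + 1 := fun h => hx (Fin.ext (by simpa using h))
  have := x.2
  have := i.2
  by_cases h : (x : ℕ) ≤ i
  · refine ⟨⟨x, by omega⟩, ?_⟩
    unfold chi
    rw [if_pos (by simpa using h)]
    rfl
  · refine ⟨⟨x - 1, by omega⟩, ?_⟩
    unfold chi
    rw [if_neg (by simp; omega)]
    apply Fin.ext
    simp
    omega

theorem mem_chiF {m : ℕ} (i : Fin m) (σ : Finset (Fin m)) (j : Fin m) :
    chi i j ∈ chiF i σ ↔ j ∈ σ := by
  unfold chiF
  simp only [Finset.mem_image]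
  exact ⟨fun ⟨k, hk, e⟩ => chi_inj i e ▸ hk, fun h => ⟨j, h, rfl⟩⟩

theorem cast_mem_chiF {m : ℕ} (i : Fin m) (σ : Finset (Fin m)) :
    i.castSucc ∈ chiF i σ ↔ i ∈ σ := by rw [← chi_self, mem_chiF]

theorem succ_notMem_chiF {m : ℕ} (i : Fin m) (σ : Finset (Fin m)) : i.succ ∉ chiF i σ := by
  unfold chiF
  simp only [Finset.mem_image, not_exists, not_and]
  exact fun j _ => chi_ne i j

/-- Extensionality through `χ_i`. -/
theorem ext_chi {m : ℕ} (i : Fin m) (A B : Finset (Fin (m + 1)))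
    (h : ∀ j, chi i j ∈ A ↔ chi i j ∈ B) (hs : i.succ ∈ A ↔ i.succ ∈ B) : A = B := by
  ext x
  by_cases hx : x = i.succ
  · rw [hx]; exact hs
  · obtain ⟨j, rfl⟩ := chi_surj i x hx
    exact h j

theorem mem_tt {m : ℕ} (i : Fin m) (A : Finset (Fin (m + 1))) (j : Fin m) :
    j ∈ tt i A ↔ chi i j ∈ A := by simp [tt]

theorem chiF_insert {m : ℕ} (i j : Fin m) (σ : Finset (Fin m)) :
    chiF i (insert j σ) = insert (chi i j) (chiF i σ) := by
  simp [chiF, Finset.image_insert]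

theorem chiF_erase {m : ℕ} (i j : Fin m) (σ : Finset (Fin m)) :
    chiF i (σ.erase j) = (chiF i σ).erase (chi i j) := by
  simp [chiF, Finset.image_erase (chi_inj i)]

theorem chiF_disj {m : ℕ} (i : Fin m) (σ τ : Finset (Fin m)) (h : Disjoint σ τ) :
    Disjoint (chiF i σ) (chiF i τ) := by
  unfold chiF
  exact (Finset.disjoint_image (chi_inj i)).2 h

theorem mem_wedge {m : ℕ} (K : ASC m) (i : Fin m) (A : Finset (Fin (m + 1))) :
    A ∈ wedgeFaces K i ↔ (tt i A).erase i ∈ K.faces ∧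
      (i.castSucc ∈ A → i.succ ∈ A → tt i A ∈ K.faces) := by
  constructor
  · rintro ⟨α, t, rfl, h⟩
    have key : (α ⊆ {i.castSucc, i.succ} ∧ t ∈ K.faces ∧ i ∉ t) := by
      rcases h with h | h | h
      · exact ⟨h.1.trans (by simp), h.2⟩
      · exact ⟨h.1.trans (by simp), h.2⟩
      · exact ⟨h.1, h.2.1, h.2.2.1⟩
    have sub : ∀ j, j ∈ tt i (α ∪ chiF i t) → j = i ∨ j ∈ t := by
      intro j hj
      rw [mem_tt, Finset.mem_union, mem_chiF] at hj
      rcases hj with hj | hj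
      · have := key.1 hj
        simp only [Finset.mem_insert, Finset.mem_singleton, chi_ne, or_false] at this
        rw [← chi_self] at this
        exact Or.inl (chi_inj i this)
      · exact Or.inr hj
    refine ⟨K.down_closed key.2.1 ?_, ?_⟩
    · intro j hj
      rw [Finset.mem_erase] at hj
      exact (sub j hj.2).resolve_left hj.1
    · intro ha hc
      rw [Finset.mem_union, cast_mem_chiF] at ha
      rw [Finset.mem_union] at hc
      have hc := hc.resolve_right (succ_notMem_chiF i t)
      have ha := ha.resolve_right key.2.2
      have hne : i.castSucc ≠ i.succ := by rw [← chi_self]; exact chi_ne i i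
      rcases h with h | h | h
      · exact absurd (Finset.mem_singleton.1 (h.1 hc)).symm hne
      · exact absurd (Finset.mem_singleton.1 (h.1 ha)) hne
      · refine K.down_closed h.2.2.2 ?_
        intro j hj
        rw [Finset.mem_insert]
        exact sub j hj
  · rintro ⟨h1, h2⟩
    refine ⟨A.filter (fun x => x = i.castSucc ∨ x = i.succ), (tt i A).erase i, ?_, ?_⟩
    · apply ext_chi i
      · intro j
        rw [Finset.mem_union, mem_chiF, Finset.mem_filter, Finset.mem_erase, mem_tt, ← chi_self,
          (chi_inj i).eq_iff]
        tauto
      · simp [succ_notMem_chiF]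
    · by_cases ha : i.castSucc ∈ A
      · by_cases hc : i.succ ∈ A
        · refine Or.inr (Or.inr ⟨?_, h1, by simp, ?_⟩)
          · intro x hx
            simpa using (Finset.mem_filter.1 hx).2
          · refine K.down_closed (h2 ha hc) ?_
            intro j hj
            simp only [Finset.mem_insert, Finset.mem_erase] at hj
            rcases hj with rfl | hj
            · rw [mem_tt, chi_self]; exact ha
            · exact hj.2
        · refine Or.inl ⟨?_, h1, by simp⟩
          intro x hx
          rw [Finset.mem_filter] at hx
          rcases hx.2 with h | h
          · simp [h]
          · exact absurd (h ▸ hx.1) hc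
      · refine Or.inr (Or.inl ⟨?_, h1, by simp⟩)
        intro x hx
        rw [Finset.mem_filter] at hx
        rcases hx.2 with h | h
        · exact absurd (h ▸ hx.1) ha
        · simp [h]

theorem wedge_down {m : ℕ} (K : ASC m) (i : Fin m) (σ τ : Finset (Fin (m + 1)))
    (h : σ ∈ wedgeFaces K i) (hs : τ ⊆ σ) : τ ∈ wedgeFaces K i := by
  rw [mem_wedge] at *
  have hsub : tt i τ ⊆ tt i σ := by
    intro j; rw [mem_tt, mem_tt]; exact fun h => hs h
  exact ⟨K.down_closed h.1 (Finset.erase_subset_erase _ hsub),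
    fun ha hc => K.down_closed (h.2 (hs ha) (hs hc)) hsub⟩

theorem tt_chiF {m : ℕ} (i : Fin m) (σ : Finset (Fin m)) : tt i (chiF i σ) = σ := by
  ext j; rw [mem_tt, mem_chiF]

theorem tt_insert_succ {m : ℕ} (i : Fin m) (A : Finset (Fin (m + 1))) :
    tt i (insert i.succ A) = tt i A := by
  ext j; simp [mem_tt, chi_ne]

theorem tt_erase_succ {m : ℕ} (i : Fin m) (A : Finset (Fin (m + 1))) :
    tt i (A.erase i.succ) = tt i A := by
  ext j; simp [mem_tt, chi_ne]

theorem wedge_chiF {m : ℕ} (K : ASC m) (i : Fin m) (σ : Finset (Fin m)) (h : σ ∈ K.faces) :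
    chiF i σ ∈ wedgeFaces K i := by
  rw [mem_wedge, tt_chiF]
  exact ⟨K.down_closed h (Finset.erase_subset _ _), fun _ _ => h⟩

theorem wedge_chiF_iff {m : ℕ} (K : ASC m) (i : Fin m) (σ : Finset (Fin m)) (hi : i ∉ σ) :
    chiF i σ ∈ wedgeFaces K i ↔ σ ∈ K.faces := by
  refine ⟨fun h => ?_, wedge_chiF K i σ⟩
  rw [mem_wedge, tt_chiF, Finset.erase_eq_of_notMem hi] at h
  exact h.1

theorem wedge_insert_iff {m : ℕ} (K : ASC m) (i : Fin m) (σ : Finset (Fin m)) :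
    insert i.succ (chiF i σ) ∈ wedgeFaces K i ↔ σ ∈ K.faces := by
  rw [mem_wedge, tt_insert_succ, tt_chiF]
  have hne : i.castSucc ≠ i.succ := by rw [← chi_self]; exact chi_ne i i
  constructor
  · rintro ⟨h1, h2⟩
    by_cases hi : i ∈ σ
    · exact h2 (by simp [cast_mem_chiF, hi]) (by simp)
    · rwa [Finset.erase_eq_of_notMem hi] at h1
  · intro h
    exact ⟨K.down_closed h (Finset.erase_subset _ _), fun _ _ => h⟩

/-- cone property at `i` -/
theorem wedge_cone_cast {m : ℕ} (K : ASC m) (i : Fin m) (A : Finset (Fin (m + 1)))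
    (hc : i.succ ∉ A) (h : A ∈ wedgeFaces K i) : insert i.castSucc A ∈ wedgeFaces K i := by
  have hne : i.succ ≠ i.castSucc := by rw [← chi_self]; exact (chi_ne i i).symm
  rw [mem_wedge] at *
  refine ⟨K.down_closed h.1 ?_, fun _ h' => absurd h' (by simp [hne, hc])⟩
  intro j
  simp only [Finset.mem_erase, mem_tt, Finset.mem_insert, ← chi_self i, (chi_inj i).eq_iff]
  tauto

/-- cone property at `i+1` -/
theorem wedge_cone_succ {m : ℕ} (K : ASC m) (i : Fin m) (A : Finset (Fin (m + 1)))
    (hc : i.castSucc ∉ A) (h : A ∈ wedgeFaces K i) : insert i.succ A ∈ wedgeFaces K i := by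
  have hne : i.castSucc ≠ i.succ := by rw [← chi_self]; exact chi_ne i i
  rw [mem_wedge] at *
  rw [tt_insert_succ]
  exact ⟨h.1, fun h' => absurd h' (by simp [hne, hc])⟩

/-! ### The map `ϖ_i` on monomials -/

/-- the sign of the right multiplication by `u^{i+1}`. -/
def eps {m : ℕ} (i : Fin m) (A : Finset (Fin (m + 1))) : ℤ :=
  (-1) ^ (∑ k ∈ A, (({i.succ} : Finset (Fin (m + 1))).filter (fun l => l < k)).card)

theorem eps_sq {m : ℕ} (i : Fin m) (A : Finset (Fin (m + 1))) : eps i A * eps i A = 1 := by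
  unfold eps
  rw [← mul_pow]; simp

theorem eps_insert {m : ℕ} (i : Fin m) (A : Finset (Fin (m + 1))) (k : Fin (m + 1)) (hk : k ∉ A) :
    eps i (insert k A) = (if i.succ < k then -1 else 1) * eps i A := by
  unfold eps
  rw [Finset.sum_insert hk, pow_add, Finset.filter_singleton]
  congr 1
  split_ifs <;> simp

theorem mulMon_eq {F : Set (Finset (Fin n))} (a b : MonIdx F)
    (h : (a.1.1 ∪ b.1.1) ∈ F ∧ Disjoint a.1.1 b.1.1 ∧ Disjoint a.1.2 b.1.1) :
    mulMon F a b = ((-1 : ℤ) ^ (∑ i ∈ a.1.1, ((b.1.1).filter (fun k => k < i)).card)) •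
      mon F (a.1.1 ∪ b.1.1) ((a.1.2 ∪ b.1.2) \ (a.1.1 ∪ b.1.1)) := by
  unfold mulMon
  refine (dif_pos h).trans ?_
  unfold mon
  rw [dif_pos ⟨h.1, Finset.disjoint_sdiff⟩]
  rfl

theorem mulR_single {F : Set (Finset (Fin n))} (a b : MonIdx F) :
    mulR F (Finsupp.single a 1) (Finsupp.single b 1) = mulMon F a b := by
  unfold mulR
  have h1 : ∀ (M : Type) [AddCommGroup M] (g : MonIdx F → M) (c : MonIdx F),
      Finsupp.lift M ℤ (MonIdx F) g (Finsupp.single c 1) = g c := by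
    intro M _ g c
    exact (Finsupp.sum_single_index (by simp)).trans (one_smul ℤ _)
  rw [h1, h1]

theorem succ_single_mem {m : ℕ} (K : ASC m) (i : Fin m) :
    ({i.succ} : Finset (Fin (m + 1))) ∈ wedgeFaces K i := by
  have := (wedge_insert_iff K i ∅).2 K.empty_mem
  simpa [chiF] using this

theorem varpi_mon {m : ℕ} (K : ASC m) (i : Fin m) {σ τ : Finset (Fin m)} (hd : Disjoint σ τ) :
    varpi K i (mon K.faces σ τ) =
      if i ∈ σ ∪ τ then eps i (chiF i σ) •
        mon (wedgeFaces K i) (insert i.succ (chiF i σ)) (chiF i τ)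
      else mon (wedgeFaces K i) (chiF i σ) (chiF i τ) := by
  by_cases hσ : σ ∈ K.faces
  · have hh : chiF i σ ∈ wedgeFaces K i ∧ Disjoint (chiF i σ) (chiF i τ) :=
      ⟨wedge_chiF K i σ hσ, chiF_disj i σ τ hd⟩
    unfold varpi
    rw [lift_mon _ ⟨hσ, hd⟩]
    refine (dif_pos hh).trans ?_
    by_cases hi : i ∈ σ ∪ τ
    · refine (if_pos hi).trans ?_
      rw [if_pos hi]
      unfold genV
      rw [dif_pos (succ_single_mem K i)]
      refine (mulR_single _ _).trans ?_
      have hu : chiF i σ ∪ {i.succ} = insert i.succ (chiF i σ) := by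
        rw [Finset.union_comm]; rfl
      refine (mulMon_eq _ _ ?_).trans ?_
      rotate_left
      · dsimp only
        rw [hu]
        unfold eps
        congr 2
        rw [Finset.union_empty, Finset.sdiff_eq_self_iff_disjoint, Finset.disjoint_insert_right]
        exact ⟨succ_notMem_chiF i τ, hh.2.symm⟩
      · dsimp only
        rw [hu]
        refine ⟨(wedge_insert_iff K i σ).2 hσ, ?_, ?_⟩
        · simpa using succ_notMem_chiF i σ
        · simpa using succ_notMem_chiF i τ
    · refine (if_neg hi).trans ?_
      rw [if_neg hi]
      unfold mon
      rw [dif_pos hh]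
  · rw [mon_zero hσ, map_zero]
    split_ifs with hi
    · rw [mon_zero, smul_zero]
      rwa [wedge_insert_iff]
    · rw [mon_zero]
      rwa [wedge_chiF_iff]
      exact fun h => hi (Finset.mem_union_left _ h)

theorem sgn_chiF {m : ℕ} (i j : Fin m) (σ : Finset (Fin m)) :
    sgn (chi i j) (chiF i σ) = sgn j σ := by
  unfold sgn chiF
  rw [Finset.filter_image, Finset.card_image_of_injective _ (chi_inj i)]
  simp only [chi_lt]

theorem sum_chiF {m : ℕ} (i : Fin m) (τ : Finset (Fin m)) {M : Type*} [AddCommMonoid M]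
    (f : Fin (m + 1) → M) : ∑ j ∈ chiF i τ, f j = ∑ j ∈ τ, f (chi i j) := by
  unfold chiF
  rw [Finset.sum_image (fun a _ b _ h => chi_inj i h)]

theorem disj_ins {m : ℕ} (i : Fin m) {σ τ : Finset (Fin m)} (hd : Disjoint σ τ) :
    Disjoint (insert i.succ (chiF i σ)) (chiF i τ) := by
  rw [Finset.disjoint_insert_left]
  exact ⟨succ_notMem_chiF i τ, chiF_disj i σ τ hd⟩

theorem varpi_dR {m : ℕ} (K : ASC m) (i : Fin m) (x : RMod K.faces) :
    varpi K i (dR K.faces x) = dR (wedgeFaces K i) (varpi K i x) := by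
  suffices h : (varpi K i).comp (dR K.faces) = (dR (wedgeFaces K i)).comp (varpi K i) from
    LinearMap.congr_fun h x
  apply lin_ext
  intro σ τ hσ hd
  rw [LinearMap.comp_apply, LinearMap.comp_apply, dR_mon (fun _ _ => K.down_closed) hd,
    varpi_mon K i hd, map_sum]
  have hw : ∀ j ∈ τ, insert j σ ∪ τ.erase j = σ ∪ τ := by
    intro j hj
    ext k
    simp only [Finset.mem_union, Finset.mem_insert, Finset.mem_erase]
    by_cases h : k = j
    · subst h; simp [hj]
    · simp [h]
  by_cases hi : i ∈ σ ∪ τ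
  · rw [if_pos hi, map_smul, dR_mon (wedge_down K i) (disj_ins i hd), sum_chiF, Finset.smul_sum]
    apply Finset.sum_congr rfl
    intro j hj
    have hj' : j ∉ σ := fun h => Finset.disjoint_left.1 hd h hj
    rw [map_smul, varpi_mon K i (disj_step hd j), if_pos (by rw [hw j hj]; exact hi), smul_smul,
      smul_smul, chiF_insert, chiF_erase, Finset.insert_comm,
      eps_insert _ _ _ (by rwa [mem_chiF]), sgn_insert _ _ _ (succ_notMem_chiF i σ), sgn_chiF]
    congr 1
    ring
  · rw [if_neg hi, dR_mon (wedge_down K i) (chiF_disj i _ _ hd), sum_chiF]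
    apply Finset.sum_congr rfl
    intro j hj
    rw [map_smul, varpi_mon K i (disj_step hd j), if_neg (by rw [hw j hj]; exact hi),
      chiF_insert, chiF_erase, sgn_chiF]

/-! ### The homotopy -/

/-- the contraction at the vertex `v`. -/
noncomputable def coneT (F : Set (Finset (Fin n))) (v : Fin n) (σ τ : Finset (Fin n)) : RMod F :=
  sgn v σ • mon F (σ.erase v) (insert v τ)

/-- the homotopy on monomials. -/
noncomputable def hMon {m : ℕ} (K : ASC m) (i : Fin m) (σ τ : Finset (Fin (m + 1))) :
    RMod (wedgeFaces K i) :=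
  if i.succ ∈ σ then
    (if i.castSucc ∈ σ ∪ τ then 0 else coneT (wedgeFaces K i) i.succ σ τ)
  else (if i.castSucc ∈ σ then coneT (wedgeFaces K i) i.castSucc σ τ else 0)

/-- the homotopy. -/
noncomputable def hMap {m : ℕ} (K : ASC m) (i : Fin m) :
    RMod (wedgeFaces K i) →ₗ[ℤ] RMod (wedgeFaces K i) :=
  Finsupp.lift (RMod (wedgeFaces K i)) ℤ (MonIdx (wedgeFaces K i)) fun b => hMon K i b.1.1 b.1.2

theorem hMap_mon {m : ℕ} (K : ASC m) (i : Fin m) {σ τ : Finset (Fin (m + 1))}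
    (hd : Disjoint σ τ) : hMap K i (mon (wedgeFaces K i) σ τ) = hMon K i σ τ := by
  by_cases h : σ ∈ wedgeFaces K i
  · unfold hMap
    rw [lift_mon _ ⟨h, hd⟩]
  · rw [mon_zero h, map_zero]
    symm
    unfold hMon coneT
    split_ifs with h1 h2 h3
    · rfl
    · rw [mon_zero, smul_zero]
      intro h'
      apply h
      have := wedge_cone_succ K i _ (fun h'' => h2 (Finset.mem_union_left _
        (Finset.mem_of_mem_erase h''))) h'
      rwa [Finset.insert_erase h1] at this
    · rw [mon_zero, smul_zero]
      intro h'
      apply h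
      have := wedge_cone_cast K i _ (fun h'' => h1 (Finset.mem_of_mem_erase h'')) h'
      rwa [Finset.insert_erase h3] at this
    · rfl

/-- `E = 1 - dh - hd`. -/
noncomputable def eMap {m : ℕ} (K : ASC m) (i : Fin m) :
    RMod (wedgeFaces K i) →ₗ[ℤ] RMod (wedgeFaces K i) :=
  LinearMap.id - (dR (wedgeFaces K i)).comp (hMap K i) - (hMap K i).comp (dR (wedgeFaces K i))

theorem eMap_apply {m : ℕ} (K : ASC m) (i : Fin m) (y : RMod (wedgeFaces K i)) :
    eMap K i y = y - dR _ (hMap K i y) - hMap K i (dR _ y) := rfl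

theorem eMap_dR {m : ℕ} (K : ASC m) (i : Fin m) (y : RMod (wedgeFaces K i)) :
    dR _ (eMap K i y) = eMap K i (dR _ y) := by
  simp only [eMap_apply, map_sub, dR_dR (wedge_down K i), map_zero]
  abel

/-- the good monomials: image of `ϖ_i`. -/
def Good {m : ℕ} (i : Fin m) (σ τ : Finset (Fin (m + 1))) : Prop :=
  (i.castSucc ∈ σ ∪ τ ∧ i.succ ∈ σ) ∨ (i.castSucc ∉ σ ∪ τ ∧ i.succ ∉ σ ∪ τ)

theorem hdR_mon {m : ℕ} (K : ASC m) (i : Fin m) {σ τ : Finset (Fin (m + 1))}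
    (hd : Disjoint σ τ) : hMap K i (dR _ (mon (wedgeFaces K i) σ τ)) =
      ∑ j ∈ τ, sgn j σ • hMon K i (insert j σ) (τ.erase j) := by
  rw [dR_mon (wedge_down K i) hd, map_sum]
  apply Finset.sum_congr rfl
  intro j _
  rw [map_smul, hMap_mon K i (disj_step hd j)]

theorem cs_ne {m : ℕ} (i : Fin m) : i.castSucc ≠ i.succ := by rw [← chi_self]; exact chi_ne i i

theorem eMap_good {m : ℕ} (K : ASC m) (i : Fin m) {σ τ : Finset (Fin (m + 1))}
    (hd : Disjoint σ τ) (hg : Good i σ τ) :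
    eMap K i (mon (wedgeFaces K i) σ τ) = mon (wedgeFaces K i) σ τ := by
  have h1 : hMon K i σ τ = 0 := by
    unfold hMon
    rcases hg with ⟨h1, h2⟩ | ⟨h1, h2⟩
    · rw [if_pos h2, if_pos h1]
    · simp only [Finset.mem_union, not_or] at h1 h2
      rw [if_neg h2.1, if_neg h1.1]
  have h2 : ∀ j ∈ τ, sgn j σ • hMon K i (insert j σ) (τ.erase j) = 0 := by
    intro j hj
    unfold hMon
    rcases hg with ⟨h1, h2⟩ | ⟨h1, h2⟩
    · rw [if_pos (Finset.mem_insert_of_mem h2), if_pos, smul_zero]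
      simp only [Finset.mem_union, Finset.mem_insert, Finset.mem_erase] at *
      tauto
    · simp only [Finset.mem_union, not_or] at h1 h2
      rw [if_neg, if_neg, smul_zero]
      · rw [Finset.mem_insert, not_or]
        exact ⟨fun h => h1.2 (h ▸ hj), h1.1⟩
      · rw [Finset.mem_insert, not_or]
        exact ⟨fun h => h2.2 (h ▸ hj), h2.1⟩
  rw [eMap_apply, hMap_mon K i hd, hdR_mon K i hd, h1, Finset.sum_eq_zero h2]
  simp

/-- the submodule spanned by good monomials. -/
def goodSub {m : ℕ} (K : ASC m) (i : Fin m) : Submodule ℤ (RMod (wedgeFaces K i)) :=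
  Finsupp.supported ℤ ℤ {b : MonIdx (wedgeFaces K i) | Good i b.1.1 b.1.2}

theorem mon_good {m : ℕ} (K : ASC m) (i : Fin m) {σ τ : Finset (Fin (m + 1))}
    (hg : Good i σ τ) : mon (wedgeFaces K i) σ τ ∈ goodSub K i := by
  unfold mon goodSub
  split_ifs
  · exact Finsupp.single_mem_supported _ _ hg
  · exact Submodule.zero_mem _

theorem sgn_insert_self (v : Fin n) (σ : Finset (Fin n)) (hv : v ∉ σ) :
    sgn v (insert v σ) = sgn v σ := by
  rw [sgn_insert _ _ _ hv]; simp

theorem dR_cone {m : ℕ} (K : ASC m) (i : Fin m) {v : Fin (m + 1)} {ρ τ : Finset (Fin (m + 1))}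
    (hd : Disjoint (insert v ρ) τ) (hv : v ∉ ρ) :
    dR _ (coneT (wedgeFaces K i) v (insert v ρ) τ) = mon _ (insert v ρ) τ -
      ∑ j ∈ τ, sgn j (insert v ρ) • coneT (wedgeFaces K i) v (insert j (insert v ρ)) (τ.erase j) := by
  have hvt : v ∉ τ := fun h => Finset.disjoint_left.1 hd (Finset.mem_insert_self _ _) h
  have hd2 : Disjoint ρ (insert v τ) := by
    rw [Finset.disjoint_insert_left] at hd
    rw [Finset.disjoint_insert_right]
    exact ⟨hv, hd.2⟩
  unfold coneT
  rw [map_smul, sgn_insert_self _ _ hv, Finset.erase_insert hv, dR_mon (wedge_down K i) hd2,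
    cone_lem hd hv]
  congr 1
  apply Finset.sum_congr rfl
  intro j hj
  have hjv : j ≠ v := fun h => hvt (h ▸ hj)
  have hvj : v ∉ insert j ρ := by
    rw [Finset.mem_insert, not_or]; exact ⟨hjv.symm, hv⟩
  rw [smul_smul, Finset.insert_comm, sgn_insert_self _ _ hvj, Finset.erase_insert hvj]

theorem eMap_mem {m : ℕ} (K : ASC m) (i : Fin m) {σ τ : Finset (Fin (m + 1))}
    (hσ : σ ∈ wedgeFaces K i) (hd : Disjoint σ τ) :
    eMap K i (mon (wedgeFaces K i) σ τ) ∈ goodSub K i := by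
  by_cases hg : Good i σ τ
  · rw [eMap_good K i hd hg]; exact mon_good K i hg
  have hne := cs_ne i
  rw [eMap_apply, hMap_mon K i hd, hdR_mon K i hd]
  by_cases hc : i.succ ∈ σ
  · -- cone at `i+1`
    have ha : i.castSucc ∉ σ ∪ τ := fun h => hg (Or.inl ⟨h, hc⟩)
    obtain ⟨ρ, hρ, rfl⟩ : ∃ ρ, i.succ ∉ ρ ∧ σ = insert i.succ ρ :=
      ⟨σ.erase i.succ, by simp, (Finset.insert_erase hc).symm⟩
    have e1 : hMon K i (insert i.succ ρ) τ = coneT _ i.succ (insert i.succ ρ) τ := by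
      unfold hMon; rw [if_pos hc, if_neg ha]
    have e2 : ∀ j ∈ τ, sgn j (insert i.succ ρ) • hMon K i (insert j (insert i.succ ρ)) (τ.erase j) =
        sgn j (insert i.succ ρ) • coneT (wedgeFaces K i) i.succ (insert j (insert i.succ ρ))
          (τ.erase j) := by
      intro j hj
      congr 1
      unfold hMon
      rw [if_pos (Finset.mem_insert_of_mem hc), if_neg]
      intro h
      apply ha
      simp only [Finset.mem_union, Finset.mem_insert, Finset.mem_erase] at h ⊢
      rcases h with (h | h) | h
      · right; rw [h]; exact hj
      · tauto
      · tauto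
    rw [e1, Finset.sum_congr rfl e2, dR_cone K i hd hρ]
    simp
  by_cases ha : i.castSucc ∈ σ
  · -- cone at `i`
    obtain ⟨ρ, hρ, rfl⟩ : ∃ ρ, i.castSucc ∉ ρ ∧ σ = insert i.castSucc ρ :=
      ⟨σ.erase i.castSucc, by simp, (Finset.insert_erase ha).symm⟩
    have e1 : hMon K i (insert i.castSucc ρ) τ = coneT _ i.castSucc (insert i.castSucc ρ) τ := by
      unfold hMon; rw [if_neg hc, if_pos ha]
    rw [e1, dR_cone K i hd hρ]
    rw [sub_sub_cancel, ← Finset.sum_sub_distrib]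
    apply Submodule.sum_mem
    intro j hj
    by_cases hj' : j = i.succ
    · subst hj'
      have e3 : hMon K i (insert i.succ (insert i.castSucc ρ)) (τ.erase i.succ) = 0 := by
        unfold hMon
        rw [if_pos (Finset.mem_insert_self _ _), if_pos]
        simp
      rw [e3, smul_zero, sub_zero]
      apply Submodule.smul_mem
      apply Submodule.smul_mem
      apply mon_good
      left
      constructor
      · simp
      · simp [hne.symm]
    · have e3 : hMon K i (insert j (insert i.castSucc ρ)) (τ.erase j) =
          coneT _ i.castSucc (insert j (insert i.castSucc ρ)) (τ.erase j) := by
        unfold hMon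
        rw [if_neg, if_pos (Finset.mem_insert_of_mem ha)]
        rw [Finset.mem_insert, not_or]
        exact ⟨fun h => hj' h.symm, hc⟩
      rw [e3, sub_self]
      exact Submodule.zero_mem _
  · have e1 : hMon K i σ τ = 0 := by
      unfold hMon; rw [if_neg hc, if_neg ha]
    have key : ∑ j ∈ τ, sgn j σ • hMon K i (insert j σ) (τ.erase j) = mon _ σ τ := by
      by_cases hat : i.castSucc ∈ τ
      · rw [Finset.sum_eq_single_of_mem _ hat]
        · unfold hMon coneT
          rw [if_neg (by simp [hne.symm, hc]), if_pos (Finset.mem_insert_self _ _),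
            sgn_insert_self _ _ ha, smul_smul, sgn_sq, one_smul, Finset.erase_insert ha,
            Finset.insert_erase hat]
        · intro j hj hja
          unfold hMon
          by_cases hjc : i.succ ∈ insert j σ
          · rw [if_pos hjc, if_pos, smul_zero]
            simp [hat, hja.symm]
          · rw [if_neg hjc, if_neg, smul_zero]
            simp [ha, hja.symm]
      · have hct : i.succ ∈ τ := by
          by_contra h
          exact hg (Or.inr ⟨by simp [ha, hat], by simp [hc, h]⟩)
        rw [Finset.sum_eq_single_of_mem _ hct]
        · unfold hMon coneT
          rw [if_pos (Finset.mem_insert_self _ _), if_neg (by simp [hne, ha, hat]),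
            sgn_insert_self _ _ hc, smul_smul, sgn_sq, one_smul, Finset.erase_insert hc,
            Finset.insert_erase hct]
        · intro j hj hja
          unfold hMon
          rw [if_neg (by simp [hja.symm, hc]), if_neg, smul_zero]
          rw [Finset.mem_insert, not_or]
          exact ⟨fun h => hat (h ▸ hj), ha⟩
    rw [e1, key]
    simp

/-! ### Linear maps and gradings -/

theorem mem_partSub {ι α : Type*} (f : ι → α) (a : α) (x : ι →₀ ℤ) :
    x ∈ partSub f a ↔ ∀ b, x b ≠ 0 → f b = a := by
  refine ⟨fun h b hb => h b (Finsupp.mem_support_iff.2 hb), fun h b hb => ?_⟩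
  exact h b (Finsupp.mem_support_iff.1 hb)

theorem map_mem {F : Set (Finset (Fin n))} {M : Type*} [AddCommGroup M] (P : MonIdx F → Prop)
    (S : Submodule ℤ M) (L : RMod F →ₗ[ℤ] M)
    (h : ∀ b : MonIdx F, P b → L (mon F b.1.1 b.1.2) ∈ S)
    (x : RMod F) (hx : ∀ b, x b ≠ 0 → P b) : L x ∈ S := by
  rw [← Finsupp.sum_single x, Finsupp.sum, map_sum]
  apply Submodule.sum_mem
  intro b hb
  have := h b (hx b (Finsupp.mem_support_iff.1 hb))
  rw [← single_eq_mon] at this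
  have e : Finsupp.single b (x b) = x b • Finsupp.single b (1 : ℤ) := by simp
  rw [e, map_smul]
  exact Submodule.smul_mem _ _ this

theorem mon_wrd {F : Set (Finset (Fin n))} (σ τ ω : Finset (Fin n)) (h : σ ∪ τ = ω) :
    mon F σ τ ∈ partSub wrd ω := by
  unfold mon
  split_ifs with h1
  · rw [mem_partSub]
    intro b hb
    have hb' := (Finsupp.single_apply_ne_zero.1 hb).1
    rw [hb']; exact h
  · exact Submodule.zero_mem _

theorem mon_deg {F : Set (Finset (Fin n))} (σ τ : Finset (Fin n)) (p : ℤ) (h : (σ.card : ℤ) = p) :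
    mon F σ τ ∈ partSub degMon1 p := by
  unfold mon
  split_ifs with h1
  · rw [mem_partSub]
    intro b hb
    have hb' := (Finsupp.single_apply_ne_zero.1 hb).1
    rw [hb']; exact h
  · exact Submodule.zero_mem _

theorem dR_wrd {F : Set (Finset (Fin n))} (hF : ∀ σ τ, σ ∈ F → τ ⊆ σ → τ ∈ F) (x : RMod F)
    (ω : Finset (Fin n)) (hx : x ∈ partSub wrd ω) : dR F x ∈ partSub wrd ω := by
  refine map_mem (fun b => wrd b = ω) _ _ ?_ x ((mem_partSub _ _ _).1 hx)
  intro b hb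
  rw [dR_mon hF b.2.2]
  apply Submodule.sum_mem
  intro j hj
  apply Submodule.smul_mem
  apply mon_wrd
  rw [← hb]
  unfold wrd
  ext k
  simp only [Finset.mem_union, Finset.mem_insert, Finset.mem_erase]
  by_cases h : k = j
  · subst h; simp [hj]
  · simp [h]

theorem dR_deg {F : Set (Finset (Fin n))} (hF : ∀ σ τ, σ ∈ F → τ ⊆ σ → τ ∈ F) (x : RMod F)
    (p q : ℤ) (hq : q = p + 1) (hx : x ∈ partSub degMon1 p) : dR F x ∈ partSub degMon1 q := by
  refine map_mem (fun b => degMon1 b = p) _ _ ?_ x ((mem_partSub _ _ _).1 hx)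
  intro b hb
  rw [dR_mon hF b.2.2]
  apply Submodule.sum_mem
  intro j hj
  apply Submodule.smul_mem
  apply mon_deg
  rw [Finset.card_insert_of_notMem (fun h => Finset.disjoint_left.1 b.2.2 h hj), hq, ← hb]
  unfold degMon1
  push_cast
  rfl

theorem cone_wrd {F : Set (Finset (Fin n))} (v : Fin n) (σ τ ω : Finset (Fin n)) (hv : v ∈ σ)
    (h : σ ∪ τ = ω) : coneT F v σ τ ∈ partSub wrd ω := by
  apply Submodule.smul_mem
  apply mon_wrd
  rw [← h]
  ext k
  simp only [Finset.mem_union, Finset.mem_insert, Finset.mem_erase]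
  by_cases h : k = v
  · subst h; simp [hv]
  · simp [h]

theorem cone_deg {F : Set (Finset (Fin n))} (v : Fin n) (σ τ : Finset (Fin n)) (p : ℤ) (hv : v ∈ σ)
    (h : (σ.card : ℤ) = p + 1) : coneT F v σ τ ∈ partSub degMon1 p := by
  apply Submodule.smul_mem
  apply mon_deg
  have := Finset.card_erase_add_one hv
  omega

theorem hMap_wrd {m : ℕ} (K : ASC m) (i : Fin m) (x : RMod (wedgeFaces K i))
    (ω : Finset (Fin (m + 1))) (hx : x ∈ partSub wrd ω) : hMap K i x ∈ partSub wrd ω := by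
  refine map_mem (fun b => wrd b = ω) _ _ ?_ x ((mem_partSub _ _ _).1 hx)
  intro b hb
  rw [hMap_mon K i b.2.2]
  unfold hMon
  split_ifs with h1 h2 h3
  · exact Submodule.zero_mem _
  · exact cone_wrd _ _ _ _ h1 hb
  · exact cone_wrd _ _ _ _ h3 hb
  · exact Submodule.zero_mem _

theorem hMap_deg {m : ℕ} (K : ASC m) (i : Fin m) (x : RMod (wedgeFaces K i))
    (p q : ℤ) (hq : p = q + 1) (hx : x ∈ partSub degMon1 p) : hMap K i x ∈ partSub degMon1 q := by
  refine map_mem (fun b => degMon1 b = p) _ _ ?_ x ((mem_partSub _ _ _).1 hx)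
  intro b hb
  rw [hMap_mon K i b.2.2]
  rw [hq] at hb
  unfold hMon
  split_ifs with h1 h2 h3
  · exact Submodule.zero_mem _
  · exact cone_deg _ _ _ _ h1 hb
  · exact cone_deg _ _ _ _ h3 hb
  · exact Submodule.zero_mem _

theorem eMap_wrd {m : ℕ} (K : ASC m) (i : Fin m) (x : RMod (wedgeFaces K i))
    (ω : Finset (Fin (m + 1))) (hx : x ∈ partSub wrd ω) : eMap K i x ∈ partSub wrd ω := by
  rw [eMap_apply]
  exact Submodule.sub_mem _ (Submodule.sub_mem _ hx (dR_wrd (wedge_down K i) _ _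
    (hMap_wrd K i _ _ hx))) (hMap_wrd K i _ _ (dR_wrd (wedge_down K i) _ _ hx))

theorem eMap_deg {m : ℕ} (K : ASC m) (i : Fin m) (x : RMod (wedgeFaces K i))
    (p : ℤ) (hx : x ∈ partSub degMon1 p) : eMap K i x ∈ partSub degMon1 p := by
  rw [eMap_apply]
  exact Submodule.sub_mem _ (Submodule.sub_mem _ hx (dR_deg (wedge_down K i) _ (p - 1) _ (by ring)
    (hMap_deg K i _ p _ (by ring) hx))) (hMap_deg K i _ (p + 1) _ rfl
      (dR_deg (wedge_down K i) _ p _ rfl hx))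

theorem eMap_good' {m : ℕ} (K : ASC m) (i : Fin m) (y : RMod (wedgeFaces K i)) :
    eMap K i y ∈ goodSub K i :=
  map_mem (fun _ => True) _ _ (fun b _ => eMap_mem K i b.2.1 b.2.2) y (fun _ _ => trivial)

theorem eMap_id {m : ℕ} (K : ASC m) (i : Fin m) (y : RMod (wedgeFaces K i))
    (hy : y ∈ goodSub K i) : eMap K i y = y := by
  rw [← sub_eq_zero]
  have := map_mem (fun b : MonIdx (wedgeFaces K i) => Good i b.1.1 b.1.2) ⊥
    (eMap K i - LinearMap.id) (fun b hb => by
      rw [Submodule.mem_bot, LinearMap.sub_apply, eMap_good K i b.2.2 hb]; simp) y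
    (fun b hb => (Finsupp.mem_supported ℤ y).1 hy (Finsupp.mem_support_iff.2 hb))
  exact this

/-! ### The section of `ϖ_i` -/

/-- inverse of `ϖ_i` on monomials. -/
noncomputable def sMap {m : ℕ} (K : ASC m) (i : Fin m) :
    RMod (wedgeFaces K i) →ₗ[ℤ] RMod K.faces :=
  Finsupp.lift (RMod K.faces) ℤ (MonIdx (wedgeFaces K i)) fun b =>
    (if i.succ ∈ b.1.1 then eps i (chiF i (tt i b.1.1)) else 1) • mon K.faces (tt i b.1.1) (tt i b.1.2)

theorem sMap_mon {m : ℕ} (K : ASC m) (i : Fin m) {σ τ : Finset (Fin (m + 1))}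
    (hσ : σ ∈ wedgeFaces K i) (hd : Disjoint σ τ) : sMap K i (mon _ σ τ) =
    (if i.succ ∈ σ then eps i (chiF i (tt i σ)) else 1) • mon K.faces (tt i σ) (tt i τ) := by
  unfold sMap
  rw [lift_mon _ ⟨hσ, hd⟩]

theorem sMap_varpi {m : ℕ} (K : ASC m) (i : Fin m) (x : RMod K.faces) :
    sMap K i (varpi K i x) = x := by
  suffices h : (sMap K i).comp (varpi K i) = LinearMap.id from LinearMap.congr_fun h x
  apply lin_ext
  intro σ τ hσ hd
  rw [LinearMap.comp_apply, varpi_mon K i hd, LinearMap.id_apply]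
  split_ifs with hi
  · rw [map_smul, sMap_mon K i ((wedge_insert_iff K i σ).2 hσ) (disj_ins i hd),
      if_pos (Finset.mem_insert_self _ _), tt_insert_succ, tt_chiF, tt_chiF, smul_smul, eps_sq,
      one_smul]
  · rw [sMap_mon K i (wedge_chiF K i σ hσ) (chiF_disj i _ _ hd),
      if_neg (succ_notMem_chiF i σ), tt_chiF, tt_chiF, one_smul]

theorem tt_disj {m : ℕ} (i : Fin m) {σ τ : Finset (Fin (m + 1))} (hd : Disjoint σ τ) :
    Disjoint (tt i σ) (tt i τ) := by
  rw [Finset.disjoint_left] at *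
  intro j hj hj'
  rw [mem_tt] at hj hj'
  exact hd hj hj'

theorem tt_union {m : ℕ} (i : Fin m) (σ τ : Finset (Fin (m + 1))) :
    tt i (σ ∪ τ) = tt i σ ∪ tt i τ := by
  ext j; simp [mem_tt]

theorem chiF_tt {m : ℕ} (i : Fin m) (σ : Finset (Fin (m + 1))) (h : i.succ ∉ σ) :
    chiF i (tt i σ) = σ := by
  apply ext_chi i
  · intro j; rw [mem_chiF, mem_tt]
  · simp [h, succ_notMem_chiF]

theorem insert_chiF_tt {m : ℕ} (i : Fin m) (σ : Finset (Fin (m + 1))) (h : i.succ ∈ σ) :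
    insert i.succ (chiF i (tt i σ)) = σ := by
  apply ext_chi i
  · intro j; rw [Finset.mem_insert, mem_chiF, mem_tt]; simp [chi_ne]
  · simp [h]

theorem varpi_sMap {m : ℕ} (K : ASC m) (i : Fin m) (y : RMod (wedgeFaces K i))
    (hy : y ∈ goodSub K i) : varpi K i (sMap K i y) = y := by
  rw [← sub_eq_zero]
  refine map_mem (fun b : MonIdx (wedgeFaces K i) => Good i b.1.1 b.1.2) ⊥
    ((varpi K i).comp (sMap K i) - LinearMap.id) (fun b hb => ?_) y
    (fun b hb => (Finsupp.mem_supported ℤ y).1 hy (Finsupp.mem_support_iff.2 hb))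
  rw [Submodule.mem_bot, LinearMap.sub_apply, LinearMap.comp_apply, LinearMap.id_apply, sub_eq_zero,
    sMap_mon K i b.2.1 b.2.2, map_smul, varpi_mon K i (tt_disj i b.2.2), ← tt_union]
  have hmem : i ∈ tt i (b.1.1 ∪ b.1.2) ↔ i.castSucc ∈ b.1.1 ∪ b.1.2 := by rw [mem_tt, chi_self]
  rcases hb with ⟨h1, h2⟩ | ⟨h1, h2⟩
  · rw [if_pos h2, if_pos (hmem.2 h1), smul_smul, eps_sq, one_smul, insert_chiF_tt i _ h2,
      chiF_tt i _ (fun h => Finset.disjoint_left.1 b.2.2 h2 h)]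
  · rw [Finset.mem_union, not_or] at h2
    rw [if_neg h2.1, if_neg (fun h => h1 (hmem.1 h)), one_smul, chiF_tt i _ h2.1, chiF_tt i _ h2.2]

theorem varpi_good {m : ℕ} (K : ASC m) (i : Fin m) (x : RMod K.faces) :
    varpi K i x ∈ goodSub K i := by
  refine map_mem (fun _ => True) _ _ (fun b _ => ?_) x (fun _ _ => trivial)
  rw [varpi_mon K i b.2.2]
  split_ifs with hi
  · apply Submodule.smul_mem
    apply mon_good
    left
    rw [Finset.insert_union, Finset.mem_insert, Finset.mem_union, cast_mem_chiF, cast_mem_chiF]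
    exact ⟨Or.inr (Finset.mem_union.1 hi), Finset.mem_insert_self _ _⟩
  · apply mon_good
    right
    rw [Finset.mem_union, Finset.mem_union, cast_mem_chiF, cast_mem_chiF]
    refine ⟨fun h => hi (Finset.mem_union.2 h), ?_⟩
    simp [succ_notMem_chiF]

theorem sMap_wrd {m : ℕ} (K : ASC m) (i : Fin m) (y : RMod (wedgeFaces K i))
    (ω : Finset (Fin (m + 1))) (hy : y ∈ partSub wrd ω) : sMap K i y ∈ partSub wrd (tt i ω) := by
  refine map_mem (fun b => wrd b = ω) _ _ ?_ y ((mem_partSub _ _ _).1 hy)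
  intro b hb
  rw [sMap_mon K i b.2.1 b.2.2]
  apply Submodule.smul_mem
  apply mon_wrd
  rw [← tt_union, ← hb]
  rfl

theorem chiF_card {m : ℕ} (i : Fin m) (σ : Finset (Fin m)) : (chiF i σ).card = σ.card := by
  unfold chiF
  exact Finset.card_image_of_injective _ (chi_inj i)

/-- Degree of the section on the good part, by words. -/
theorem sMap_deg {m : ℕ} (K : ASC m) (i : Fin m) (y : RMod (wedgeFaces K i))
    (ω : Finset (Fin (m + 1))) (p q : ℤ) (hg : y ∈ goodSub K i)
    (hy : y ∈ partSub wrd ω) (hp : y ∈ partSub degMon1 p)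
    (hq : (i.castSucc ∈ ω ∧ p = q + 1) ∨ (i.castSucc ∉ ω ∧ p = q)) :
    sMap K i y ∈ partSub degMon1 q := by
  refine map_mem (fun b => wrd b = ω ∧ degMon1 b = p ∧ Good i b.1.1 b.1.2) _ _ ?_ y
    (fun b hb => ⟨(mem_partSub _ _ _).1 hy b hb, (mem_partSub _ _ _).1 hp b hb,
      (Finsupp.mem_supported ℤ y).1 hg (Finsupp.mem_support_iff.2 hb)⟩)
  rintro b ⟨hw, hdeg, hb⟩
  rw [sMap_mon K i b.2.1 b.2.2]
  apply Submodule.smul_mem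
  apply mon_deg
  unfold degMon1 at hdeg
  rw [← chiF_card i]
  unfold wrd at hw
  unfold Good at hb
  rw [hw] at hb
  rcases hb with ⟨h1, h2⟩ | ⟨h1, h2⟩
  · have h3 := congrArg Finset.card (insert_chiF_tt i _ h2)
    rw [Finset.card_insert_of_notMem (succ_notMem_chiF _ _)] at h3
    rcases hq with ⟨_, hq⟩ | ⟨hq, _⟩
    · omega
    · exact absurd h1 hq
  · rcases hq with ⟨hq, _⟩ | ⟨_, hq⟩
    · exact absurd hq h1
    · rw [chiF_tt, hdeg, hq]
      intro h
      rw [← hw] at h2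
      exact h2 (Finset.mem_union_left _ h)

theorem varpi_wrd_in {m : ℕ} (K : ASC m) (i : Fin m) (ω : Finset (Fin m)) (hi : i ∈ ω) (p : ℤ)
    (x : RMod K.faces) (hx : x ∈ partSub wrd ω) (hp : x ∈ partSub degMon1 p) :
    varpi K i x ∈ partSub wrd (chiF i ω ∪ {i.succ}) ∧ varpi K i x ∈ partSub degMon1 (p + 1) := by
  constructor
  · refine map_mem (fun b => wrd b = ω) _ _ ?_ x ((mem_partSub _ _ _).1 hx)
    intro b hb
    unfold wrd at hb
    rw [varpi_mon K i b.2.2, hb, if_pos hi]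
    apply Submodule.smul_mem
    apply mon_wrd
    rw [← hb]
    unfold chiF
    rw [Finset.image_union, Finset.insert_union, Finset.union_comm _ {i.succ}]
    rfl
  · refine map_mem (fun b => wrd b = ω ∧ degMon1 b = p) _ _ ?_ x
      (fun b hb => ⟨(mem_partSub _ _ _).1 hx b hb, (mem_partSub _ _ _).1 hp b hb⟩)
    rintro b ⟨hb, hdeg⟩
    unfold wrd at hb
    rw [varpi_mon K i b.2.2, hb, if_pos hi]
    apply Submodule.smul_mem
    apply mon_deg
    rw [Finset.card_insert_of_notMem (succ_notMem_chiF _ _), chiF_card, ← hdeg]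
    unfold degMon1
    push_cast
    rfl

theorem varpi_wrd_out {m : ℕ} (K : ASC m) (i : Fin m) (ω : Finset (Fin m)) (hi : i ∉ ω) (p : ℤ)
    (x : RMod K.faces) (hx : x ∈ partSub wrd ω) (hp : x ∈ partSub degMon1 p) :
    varpi K i x ∈ partSub wrd (chiF i ω) ∧ varpi K i x ∈ partSub degMon1 p := by
  constructor
  · refine map_mem (fun b => wrd b = ω) _ _ ?_ x ((mem_partSub _ _ _).1 hx)
    intro b hb
    unfold wrd at hb
    rw [varpi_mon K i b.2.2, hb, if_neg hi]
    apply mon_wrd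
    rw [← hb]
    unfold chiF
    rw [Finset.image_union]
  · refine map_mem (fun b => wrd b = ω ∧ degMon1 b = p) _ _ ?_ x
      (fun b hb => ⟨(mem_partSub _ _ _).1 hx b hb, (mem_partSub _ _ _).1 hp b hb⟩)
    rintro b ⟨hb, hdeg⟩
    unfold wrd at hb
    rw [varpi_mon K i b.2.2, hb, if_neg hi]
    apply mon_deg
    rw [chiF_card, ← hdeg]
    rfl

theorem varpi_inj {m : ℕ} (K : ASC m) (i : Fin m) : Function.Injective (varpi K i) :=
  Function.LeftInverse.injective (sMap_varpi K i)

/-- injectivity in cohomology -/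
theorem main_inj {m : ℕ} (K : ASC m) (i : Fin m) (x : RMod K.faces) (z : RMod (wedgeFaces K i))
    (h : varpi K i x = dR _ z) : x = dR _ (sMap K i (eMap K i z)) := by
  apply varpi_inj K i
  rw [varpi_dR, varpi_sMap K i _ (eMap_good' K i z), eMap_dR, ← h, eMap_id K i _ (varpi_good K i x)]

/-- surjectivity in cohomology -/
theorem main_surj {m : ℕ} (K : ASC m) (i : Fin m) (y : RMod (wedgeFaces K i))
    (h : dR _ y = 0) : dR _ (sMap K i (eMap K i y)) = 0 ∧
      y - varpi K i (sMap K i (eMap K i y)) = dR _ (hMap K i y) := by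
  rw [varpi_sMap K i _ (eMap_good' K i y)]
  constructor
  · apply varpi_inj K i
    rw [varpi_dR, varpi_sMap K i _ (eMap_good' K i y), eMap_dR, h, map_zero, map_zero]
  · rw [eMap_apply, h, map_zero]
    abel

theorem tt_in {m : ℕ} (i : Fin m) (ω : Finset (Fin m)) : tt i (chiF i ω ∪ {i.succ}) = ω := by
  rw [Finset.union_comm]
  exact (tt_insert_succ i _).trans (tt_chiF i ω)

theorem stmt8 (hiK : ({i} : Finset (Fin m)) ∈ K.faces) :
    -- ϖ_i commutes with the differentials
    (∀ x, varpi K i (dR K.faces x) = dR (wedgeFaces K i) (varpi K i x)) ∧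
    -- for i ∈ ω : H^p(R*_K|_ω) ≅ H^{p+1}(R*_{K(v_i)}|_{χ_i(ω)∪{i+1}})
    (∀ (ω : Finset (Fin m)) (p : ℕ), i ∈ ω →
      (∀ x, x ∈ partSub wrd ω → x ∈ partSub degMon1 (p : ℤ) →
        varpi K i x ∈ partSub wrd (chiF i ω ∪ {i.succ}) ∧
        varpi K i x ∈ partSub degMon1 ((p : ℤ) + 1)) ∧
      (∀ x, x ∈ partSub wrd ω → x ∈ partSub degMon1 (p : ℤ) → dR K.faces x = 0 →
        (∃ z, z ∈ partSub wrd (chiF i ω ∪ {i.succ}) ∧ z ∈ partSub degMon1 (p : ℤ) ∧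
          varpi K i x = dR (wedgeFaces K i) z) →
        ∃ w, w ∈ partSub wrd ω ∧ w ∈ partSub degMon1 ((p : ℤ) - 1) ∧
          x = dR K.faces w) ∧
      (∀ y, y ∈ partSub wrd (chiF i ω ∪ {i.succ}) → y ∈ partSub degMon1 ((p : ℤ) + 1) →
        dR (wedgeFaces K i) y = 0 →
        ∃ x, x ∈ partSub wrd ω ∧ x ∈ partSub degMon1 (p : ℤ) ∧ dR K.faces x = 0 ∧
          ∃ z, z ∈ partSub wrd (chiF i ω ∪ {i.succ}) ∧ z ∈ partSub degMon1 (p : ℤ) ∧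
            y - varpi K i x = dR (wedgeFaces K i) z)) ∧
    -- for i ∉ ω : H^p(R*_K|_ω) ≅ H^p(R*_{K(v_i)}|_{χ_i(ω)})
    (∀ (ω : Finset (Fin m)) (p : ℕ), i ∉ ω →
      (∀ x, x ∈ partSub wrd ω → x ∈ partSub degMon1 (p : ℤ) →
        varpi K i x ∈ partSub wrd (chiF i ω) ∧
        varpi K i x ∈ partSub degMon1 (p : ℤ)) ∧
      (∀ x, x ∈ partSub wrd ω → x ∈ partSub degMon1 (p : ℤ) → dR K.faces x = 0 →
        (∃ z, z ∈ partSub wrd (chiF i ω) ∧ z ∈ partSub degMon1 ((p : ℤ) - 1) ∧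
          varpi K i x = dR (wedgeFaces K i) z) →
        ∃ w, w ∈ partSub wrd ω ∧ w ∈ partSub degMon1 ((p : ℤ) - 1) ∧
          x = dR K.faces w) ∧
      (∀ y, y ∈ partSub wrd (chiF i ω) → y ∈ partSub degMon1 (p : ℤ) →
        dR (wedgeFaces K i) y = 0 →
        ∃ x, x ∈ partSub wrd ω ∧ x ∈ partSub degMon1 (p : ℤ) ∧ dR K.faces x = 0 ∧
          ∃ z, z ∈ partSub wrd (chiF i ω) ∧ z ∈ partSub degMon1 ((p : ℤ) - 1) ∧
            y - varpi K i x = dR (wedgeFaces K i) z)) ∧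
    -- in particular, ϖ_i induces an additive isomorphism H*(R*_K) ≅ H*(R*_{K(v_i)})
    (∀ x, dR K.faces x = 0 →
      (∃ z, varpi K i x = dR (wedgeFaces K i) z) → ∃ w, x = dR K.faces w) ∧
    (∀ y, dR (wedgeFaces K i) y = 0 →
      ∃ x, dR K.faces x = 0 ∧ ∃ z, y - varpi K i x = dR (wedgeFaces K i) z) := by
  refine ⟨varpi_dR K i, ?_, ?_, ?_, ?_⟩
  · intro ω p hi
    have hmem : i.castSucc ∈ chiF i ω ∪ {i.succ} :=
      Finset.mem_union_left _ ((cast_mem_chiF i ω).2 hi)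
    refine ⟨fun x hx hp => varpi_wrd_in K i ω hi p x hx hp, ?_, ?_⟩
    · rintro x hx hp hdx ⟨z, hz, hzp, h⟩
      have h1 := eMap_wrd K i z _ hz
      refine ⟨sMap K i (eMap K i z), ?_, ?_, main_inj K i x z h⟩
      · have h2 := sMap_wrd K i _ _ h1
        rwa [tt_in] at h2
      · exact sMap_deg K i _ _ p _ (eMap_good' K i z) h1 (eMap_deg K i z _ hzp)
          (Or.inl ⟨hmem, by ring⟩)
    · intro y hy hp hdy
      have h1 := eMap_wrd K i y _ hy
      refine ⟨sMap K i (eMap K i y), ?_, ?_, (main_surj K i y hdy).1, hMap K i y,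
        hMap_wrd K i _ _ hy, hMap_deg K i _ _ _ rfl hp, (main_surj K i y hdy).2⟩
      · have h2 := sMap_wrd K i _ _ h1
        rwa [tt_in] at h2
      · exact sMap_deg K i _ _ _ _ (eMap_good' K i y) h1 (eMap_deg K i y _ hp)
          (Or.inl ⟨hmem, rfl⟩)
  · intro ω p hi
    have hmem : i.castSucc ∉ chiF i ω := fun h => hi ((cast_mem_chiF i ω).1 h)
    refine ⟨fun x hx hp => varpi_wrd_out K i ω hi p x hx hp, ?_, ?_⟩
    · rintro x hx hp hdx ⟨z, hz, hzp, h⟩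
      have h1 := eMap_wrd K i z _ hz
      refine ⟨sMap K i (eMap K i z), ?_, ?_, main_inj K i x z h⟩
      · have h2 := sMap_wrd K i _ _ h1
        rwa [tt_chiF] at h2
      · exact sMap_deg K i _ _ _ _ (eMap_good' K i z) h1 (eMap_deg K i z _ hzp)
          (Or.inr ⟨hmem, rfl⟩)
    · intro y hy hp hdy
      have h1 := eMap_wrd K i y _ hy
      refine ⟨sMap K i (eMap K i y), ?_, ?_, (main_surj K i y hdy).1, hMap K i y,
        hMap_wrd K i _ _ hy, hMap_deg K i _ _ _ (by ring) hp, (main_surj K i y hdy).2⟩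
      · have h2 := sMap_wrd K i _ _ h1
        rwa [tt_chiF] at h2
      · exact sMap_deg K i _ _ _ _ (eMap_good' K i y) h1 (eMap_deg K i y _ hp)
          (Or.inr ⟨hmem, rfl⟩)
  · rintro x hdx ⟨z, h⟩
    exact ⟨_, main_inj K i x z h⟩
  · intro y hdy
    exact ⟨_, (main_surj K i y hdy).1, _, (main_surj K i y hdy).2⟩

end
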